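/- arXiv:1603.04894 — 4 statements merged into one kernel-verified Lean document; each statement's English description precedes it below -/
import Mathlib

section
/- Let 𝒞 be a set of nonnegative real numbers satisfying the descending chain condition. Then the set 𝒞' = {∑_{i=1}^k d_i : k ≥ 1, d_1, …, d_k ∈ 𝒞} of all sums of nonempty finite multisets of elements of 𝒞 also satisfies the descending chain condition. -/
/-- A set `S ⊆ ℝ` satisfies the descending chain condition if every
non-increasing sequence of elements of `S` is eventually constant. -/
def DCC (S : Set ℝ) : Prop :=
  ∀ f : ℕ → ℝ, (∀ m, f m ∈ S) → Antitone f → ∃ N, ∀ m, N ≤ m → f m = f N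

/-- The descending chain condition for a set of reals is well-foundedness of `<` on it. -/
theorem dcc_iff_isWF {S : Set ℝ} : DCC S ↔ S.IsWF := by
  constructor
  · intro h
    rw [Set.isWF_iff_no_descending_seq]
    intro f hf hS
    obtain ⟨N, hN⟩ := h f hS hf.antitone
    exact (hf N.lt_succ_self).ne (hN _ N.le_succ)
  · intro h f hS hf
    have hne : (Set.range f).Nonempty := Set.range_nonempty f
    have hwf : (Set.range f).IsWF := h.mono (Set.range_subset_iff.2 hS)
    obtain ⟨N, hN⟩ := hwf.min_mem hne
    exact ⟨N, fun m hm ↦ (hf hm).antisymm (hN ▸ hwf.min_le hne (Set.mem_range_self m))⟩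

/-- If `𝒞` is a set of nonnegative reals satisfying DCC, then the set of all sums of
nonempty finite multisets of elements of `𝒞` also satisfies DCC. -/
theorem stmt1 (C : Set ℝ) (hC0 : ∀ x ∈ C, 0 ≤ x) (hC : DCC C) :
    DCC {x : ℝ | ∃ s : Multiset ℝ, s ≠ 0 ∧ (∀ d ∈ s, d ∈ C) ∧ s.sum = x} := by
  rw [dcc_iff_isWF] at hC ⊢
  refine (hC.isPWO.addSubmonoid_closure hC0).isWF.mono ?_
  rintro x ⟨s, -, hs, rfl⟩
  exact AddSubmonoid.multiset_sum_mem _ s fun d hd ↦ AddSubmonoid.subset_closure (hs d hd)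
end

section
/- Let I be a subset of the real interval [0,1]. Set I₊ = {0} ∪ {∑_{p=1}^l i_p : l ≥ 1, i_1, …, i_l ∈ I} and D(I) = {(m − 1 + f)/m : m ∈ ℕ, m ≥ 1, f ∈ I₊, f ≤ 1}. Then I satisfies the descending chain condition if and only if D(I) satisfies the descending chain condition. -/
/-- The set `I₊ = {0} ∪ {∑ i_p : l ≥ 1, i_p ∈ I}` of sums of finite multisets of
elements of `I`, together with `0`. -/
def Iplus (I : Set ℝ) : Set ℝ :=
  insert 0 {x : ℝ | ∃ s : Multiset ℝ, s ≠ 0 ∧ (∀ d ∈ s, d ∈ I) ∧ s.sum = x}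

/-- The set `D(I) = {(m − 1 + f)/m : m ∈ ℕ, m ≥ 1, f ∈ I₊, f ≤ 1}`. -/
def DSet (I : Set ℝ) : Set ℝ :=
  {x : ℝ | ∃ m : ℕ, 1 ≤ m ∧ ∃ f ∈ Iplus I, f ≤ 1 ∧ x = ((m : ℝ) - 1 + f) / m}

theorem dcc_iff_isPWO (S : Set ℝ) : DCC S ↔ S.IsPWO := by
  constructor
  · intro h
    rw [Set.isPWO_iff_isWF, Set.isWF_iff_no_descending_seq]
    intro f hf hmem
    obtain ⟨N, hN⟩ := h f hmem hf.antitone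
    exact (hf (Nat.lt_succ_self N)).ne (hN (N + 1) (Nat.le_succ N))
  · intro h f hmem hf
    obtain ⟨g, hg⟩ := h.exists_monotone_subseq hmem
    refine ⟨g 0, fun m hm => le_antisymm (hf hm) ?_⟩
    calc f (g 0) ≤ f (g m) := hg (Nat.zero_le m)
      _ ≤ f m := hf (g.strictMono.le_apply)

theorem Iplus_subset_closure (I : Set ℝ) : Iplus I ⊆ (AddSubmonoid.closure I : Set ℝ) := by
  rintro x (rfl | ⟨s, -, hs, rfl⟩)
  · exact zero_mem _
  · exact AddSubmonoid.multiset_sum_mem _ s fun d hd => AddSubmonoid.subset_closure (hs d hd)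

theorem subset_DSet {I : Set ℝ} (hI : ∀ x ∈ I, x ≤ 1) : I ⊆ DSet I := fun x hx =>
  ⟨1, le_rfl, x, Or.inr ⟨{x}, by simp, by simpa using hx, by simp⟩, hI x hx, by simp⟩

theorem monotoneOn_log_adjunction_coeff :
    MonotoneOn (fun p : ℕ × ℝ => ((p.1 : ℝ) - 1 + p.2) / p.1) (Set.Ici 1 ×ˢ Set.Iic 1) := by
  rintro ⟨m, f⟩ ⟨hm, hf⟩ ⟨n, g⟩ ⟨hn, hg⟩ ⟨hmn, hfg⟩
  simp only [Set.mem_Ici, Set.mem_Iic] at hm hf hn hg hmn hfg ⊢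
  have hm' : (1 : ℝ) ≤ m := by exact_mod_cast hm
  have hmn' : (m : ℝ) ≤ n := by exact_mod_cast hmn
  rw [div_le_div_iff₀ (by linarith) (by linarith)]
  nlinarith [mul_nonneg (sub_nonneg.2 hmn') (sub_nonneg.2 hf),
    mul_nonneg (sub_nonneg.2 hfg) (zero_le_one.trans hm')]

theorem isPWO_DSet {I : Set ℝ} (hI : (Iplus I).IsPWO) : (DSet I).IsPWO := by
  have hprod : (Set.Ici (1 : ℕ) ×ˢ (Iplus I ∩ Set.Iic 1)).IsPWO :=
    (Set.isPWO_of_wellQuasiOrderedLE _).prod (hI.mono Set.inter_subset_left)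
  refine (hprod.image_of_monotoneOn (monotoneOn_log_adjunction_coeff.mono
    (Set.prod_mono_right Set.inter_subset_right))).mono ?_
  rintro x ⟨m, hm, f, hf, hf1, rfl⟩
  exact ⟨(m, f), ⟨hm, hf, hf1⟩, rfl⟩

/-- For `I ⊆ [0,1]`, `I` satisfies DCC if and only if `D(I)` satisfies DCC. -/
theorem stmt2 (I : Set ℝ) (hI : I ⊆ Set.Icc 0 1) : DCC I ↔ DCC (DSet I) := by
  rw [dcc_iff_isPWO, dcc_iff_isPWO]
  refine ⟨fun h => isPWO_DSet ?_, fun h => h.mono (subset_DSet fun x hx => (hI hx).2)⟩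
  exact (Set.IsPWO.addSubmonoid_closure (fun x hx => (hI hx).1) h).mono (Iplus_subset_closure I)
end

section
/- Let 𝒰 be a non-principal ultrafilter on ℕ, (L_m)_{m∈ℕ} a sequence of fields, k = [L_m] their ultraproduct, and n ≥ 1. Let k[x_1,…,x_n]_int = [L_m[x_1,…,x_n]] be the ultraproduct of the polynomial rings, and let φ : k[x_1,…,x_n] → k[x_1,…,x_n]_int be the natural k-algebra homomorphism sending each x_i to the class of the constant sequence (x_i), where k[x_1,…,x_n]_int is a k-algebra via the coefficientwise map [L_m] → [L_m[x_1,…,x_n]]. Then φ is injective and k[x_1,…,x_n]_int is faithfully flat as a module over k[x_1,…,x_n] via φ. -/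
/-- The ideal of the product ring `∀ m, A m` consisting of sequences vanishing on a set
belonging to the ultrafilter `𝒰`. -/
def ultraIdeal (𝒰 : Ultrafilter ℕ) (A : ℕ → Type*) [∀ m, CommRing (A m)] :
    Ideal (∀ m, A m) where
  carrier := {a : ∀ m, A m | {m | a m = 0} ∈ 𝒰}
  zero_mem' := Filter.univ_mem' (fun _ => rfl)
  add_mem' := by
    intro a b ha hb
    refine (𝒰 : Filter ℕ).mem_of_superset ((𝒰 : Filter ℕ).inter_mem ha hb) ?_
    rintro m ⟨h1, h2⟩
    simp only [Set.mem_setOf_eq] at h1 h2 ⊢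
    simp [h1, h2]
  smul_mem' := by
    intro c a ha
    refine (𝒰 : Filter ℕ).mem_of_superset ha ?_
    intro m hm
    simp only [Set.mem_setOf_eq] at hm ⊢
    simp [hm]

namespace MvPolynomial

/-- The substitution `X 0 ↦ X 0`, `X i ↦ X i + c * X 0 ^ N ^ i` for `i ≠ 0`. -/
noncomputable def shiftHom (R : Type*) [CommRing R] (n N : ℕ) (c : R) :
    MvPolynomial (Fin (n + 1)) R →ₐ[R] MvPolynomial (Fin (n + 1)) R :=
  aeval fun i => if i = 0 then X 0 else X i + c • X 0 ^ N ^ i.1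

lemma shiftHom_comp_neg (R : Type*) [CommRing R] (n N : ℕ) (c : R) :
    (shiftHom R n N c).comp (shiftHom R n N (-c)) = AlgHom.id _ _ := by
  rw [shiftHom, shiftHom, comp_aeval, ← MvPolynomial.aeval_X_left]
  ext i v
  cases i using Fin.cases <;> simp

/-- Nagata's change of variables `X i ↦ X i + X 0 ^ N ^ i` for `i ≠ 0`, followed by viewing the
result as a univariate polynomial in `X 0`. -/
noncomputable def nagataEquiv (R : Type*) [CommRing R] (n N : ℕ) :
    MvPolynomial (Fin (n + 1)) R ≃ₐ[R] Polynomial (MvPolynomial (Fin n) R) :=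
  (AlgEquiv.ofAlgHom (shiftHom R n N 1) (shiftHom R n N (-1)) (shiftHom_comp_neg R n N 1)
    (by simpa using shiftHom_comp_neg R n N (-1))).trans (finSuccEquiv R n)

section

variable {R : Type*} [CommRing R] {n N : ℕ}

lemma nagataEquiv_X_zero : nagataEquiv R n N (X 0) = Polynomial.X := by
  simp [nagataEquiv, shiftHom, finSuccEquiv_X_zero]

lemma nagataEquiv_X_succ (i : Fin n) : nagataEquiv R n N (X i.succ) =
    Polynomial.C (X i) + Polynomial.X ^ N ^ (i.1 + 1) := by
  simp [nagataEquiv, shiftHom, finSuccEquiv_X_zero, finSuccEquiv_X_succ]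

lemma nagataEquiv_C (a : R) : nagataEquiv R n N (C a) = Polynomial.C (C a) := by
  rw [← algebraMap_eq, AlgEquiv.commutes]
  rfl

lemma nagataEquiv_symm_X : (nagataEquiv R n N).symm Polynomial.X = X 0 := by
  rw [AlgEquiv.symm_apply_eq, nagataEquiv_X_zero]

variable (R n N) in
/-- The inclusion of polynomials in `n` variables into polynomials in `n + 1` variables as constant
polynomials for Nagata's change of variables. -/
noncomputable def nagataC : MvPolynomial (Fin n) R →+* MvPolynomial (Fin (n + 1)) R :=
  ((nagataEquiv R n N).symm : Polynomial (MvPolynomial (Fin n) R) →+* _).comp Polynomial.C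

lemma nagataEquiv_symm_C (p : MvPolynomial (Fin n) R) :
    (nagataEquiv R n N).symm (Polynomial.C p) = nagataC R n N p := rfl

lemma nagataC_C (a : R) : nagataC R n N (C a) = C a := by
  rw [← nagataEquiv_symm_C, AlgEquiv.symm_apply_eq, nagataEquiv_C]

lemma nagataC_X (i : Fin n) : nagataC R n N (X i) = X i.succ - X 0 ^ N ^ (i.1 + 1) := by
  rw [← nagataEquiv_symm_C, AlgEquiv.symm_apply_eq, map_sub, map_pow, nagataEquiv_X_succ,
    nagataEquiv_X_zero, add_sub_cancel_right]

end

section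

variable {k : Type*} [Field k] {n N : ℕ}

lemma sum_pow_mul_ne {v w : Fin n →₀ ℕ} (hN : 1 < N) (hv : ∀ i, v i < N) (hw : ∀ i, w i < N)
    (ne : v ≠ w) : ∑ i, N ^ i.1 * v i ≠ ∑ i, N ^ i.1 * w i := by
  intro h
  refine ne <| Finsupp.ext <| congrFun <| List.ofFn_inj.mp ?_
  apply Nat.ofDigits_inj_of_len_eq hN (by simp) (by grind) (by grind)
  simpa only [Nat.ofDigits_eq_sum_mapIdx, List.mapIdx_eq_ofFn, List.get_ofFn, List.length_ofFn,
    Fin.val_cast, mul_comm, List.sum_ofFn] using! h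

lemma nagataEquiv_monomial (v : Fin (n + 1) →₀ ℕ) (a : k) :
    nagataEquiv k n N (monomial v a) = Polynomial.C (C a) * (Polynomial.X ^ v 0 *
      ∏ i : Fin n, (Polynomial.X ^ N ^ (i.1 + 1) + Polynomial.C (X i)) ^ v i.succ) := by
  rw [monomial_eq, Finsupp.prod_pow v fun a ↦ X a, Fin.prod_univ_succ]
  simp only [map_mul, map_prod, map_pow, nagataEquiv_C, nagataEquiv_X_zero, nagataEquiv_X_succ,
    add_comm]

lemma monic_prod_shift (hN : 1 < N) (v : Fin (n + 1) →₀ ℕ) :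
    (Polynomial.X ^ v 0 * ∏ i : Fin n, (Polynomial.X ^ N ^ (i.1 + 1) +
      Polynomial.C (X i : MvPolynomial (Fin n) k)) ^ v i.succ).Monic :=
  (Polynomial.monic_X_pow _).mul <| Polynomial.monic_prod_of_monic _ _ fun i _ =>
    (Polynomial.monic_X_pow_add_C _ (by positivity)).pow _

lemma natDegree_nagataEquiv_monomial (hN : 1 < N) (v : Fin (n + 1) →₀ ℕ) {a : k} (ha : a ≠ 0) :
    (nagataEquiv k n N (monomial v a)).natDegree = ∑ i, N ^ i.1 * v i := by
  have hm (i : Fin n) : (Polynomial.X ^ N ^ (i.1 + 1) +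
      Polynomial.C (X i : MvPolynomial (Fin n) k)).Monic :=
    Polynomial.monic_X_pow_add_C _ (by positivity)
  rw [nagataEquiv_monomial, Polynomial.natDegree_C_mul (by simpa using ha),
    (Polynomial.monic_X_pow _).natDegree_mul
      (Polynomial.monic_prod_of_monic _ _ fun i _ => (hm i).pow _),
    Polynomial.natDegree_prod_of_monic _ _ fun i _ => (hm i).pow _, Fin.sum_univ_succ]
  simp [(hm _).natDegree_pow, mul_comm]

lemma leadingCoeff_nagataEquiv_monomial (hN : 1 < N) (v : Fin (n + 1) →₀ ℕ) (a : k) :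
    (nagataEquiv k n N (monomial v a)).leadingCoeff = C a := by
  rw [nagataEquiv_monomial, Polynomial.leadingCoeff_mul_monic (monic_prod_shift hN v),
    Polynomial.leadingCoeff_C]

/-- For large `N`, Nagata's change of variables makes the leading coefficient of a nonzero
polynomial a nonzero constant. -/
lemma exists_leadingCoeff_nagataEquiv {f : MvPolynomial (Fin (n + 1)) k} (hf : f ≠ 0) :
    ∃ N, ∃ a : k, a ≠ 0 ∧ (nagataEquiv k n N f).leadingCoeff = C a := by
  set N := 2 + f.totalDegree with hNdef
  have hN : 1 < N := by omega
  set h : (Fin (n + 1) →₀ ℕ) → Polynomial (MvPolynomial (Fin n) k) :=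
    fun v => nagataEquiv k n N (monomial v (coeff v f)) with hh
  have hlt (v) (hv : v ∈ f.support) (i) : v i < N :=
    lt_of_le_of_lt ((monomial_le_degreeOf i hv).trans (degreeOf_le_totalDegree f i)) (by omega)
  obtain ⟨v, hv, hmax⟩ := Finset.exists_max_image f.support (fun v => (h v).natDegree)
    (support_nonempty.mpr hf)
  have hva : coeff v f ≠ 0 := mem_support_iff.mp hv
  refine ⟨N, coeff v f, hva, ?_⟩
  have hdeg : ∀ w ∈ f.support.erase v, (h w).degree < (h v).degree := by
    intro w hw
    obtain ⟨hne, hw⟩ := Finset.mem_erase.mp hw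
    refine Polynomial.degree_lt_degree (lt_of_le_of_ne (hmax w hw) ?_)
    rw [hh]
    dsimp only
    rw [natDegree_nagataEquiv_monomial hN _ (mem_support_iff.mp hw),
      natDegree_nagataEquiv_monomial hN _ hva]
    exact sum_pow_mul_ne hN (hlt w hw) (hlt v hv) hne
  have hv0 : h v ≠ 0 := by simpa [hh] using hva
  have hsum : nagataEquiv k n N f = ∑ w ∈ f.support.erase v, h w + h v := by
    rw [Finset.sum_erase_add _ _ hv, ← map_sum, support_sum_monomial_coeff]
  rw [hsum, Polynomial.leadingCoeff_add_of_degree_lt, leadingCoeff_nagataEquiv_monomial hN]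
  refine (Polynomial.degree_sum_le _ _).trans_lt ((Finset.sup_lt_iff ?_).mpr hdeg)
  exact bot_lt_iff_ne_bot.mpr fun h0 => hv0 (Polynomial.degree_eq_bot.mp h0)

/-- Over a field, some nonzero scalar multiple of a nonzero polynomial becomes monic after Nagata's
change of variables. -/
lemma exists_monic_nagataEquiv {f : MvPolynomial (Fin (n + 1)) k} (hf : f ≠ 0) :
    ∃ N, ∃ a : k, (nagataEquiv k n N (C a * f)).Monic := by
  obtain ⟨N, a, ha, h⟩ := exists_leadingCoeff_nagataEquiv hf
  refine ⟨N, a⁻¹, ?_⟩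
  rw [Polynomial.Monic, map_mul, nagataEquiv_C, Polynomial.leadingCoeff_mul,
    Polynomial.leadingCoeff_C, h, ← map_mul, inv_mul_cancel₀ ha, map_one]

end

end MvPolynomial

/-- Division with remainder by `δ`: every element of `S` is uniquely of the form
`∑ s < d, c (u s) * x ^ s + δ * q`. -/
def HasDivision {A S : Type*} [CommRing A] [CommRing S] (c : A →+* S) (δ x : S) (d : ℕ) : Prop :=
  (∀ y, ∃ (u : Fin d → A) (q : S), ∑ s, c (u s) * x ^ s.1 + δ * q = y) ∧
    ∀ (u : Fin d → A) (q : S), ∑ s, c (u s) * x ^ s.1 + δ * q = 0 → u = 0 ∧ q = 0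

lemma Polynomial.Monic.hasDivision {A : Type*} [CommRing A] [Nontrivial A] {f : Polynomial A}
    (hf : f.Monic) : HasDivision Polynomial.C f Polynomial.X f.natDegree := by
  constructor
  · intro y
    refine ⟨fun s => (y %ₘ f).coeff s, y /ₘ f, ?_⟩
    conv_rhs => rw [← Polynomial.modByMonic_add_div y f]
    congr 1
    rw [Fin.sum_univ_eq_sum_range (fun s => C ((y %ₘ f).coeff s) * X ^ s)]
    by_cases h1 : f = 1
    · simp [h1]
    · exact ((y %ₘ f).as_sum_range_C_mul_X_pow' (natDegree_modByMonic_lt y hf h1)).symm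
  · intro u q h
    obtain ⟨hq, hr⟩ := div_modByMonic_unique q (∑ s, C (u s) * X ^ s.1) hf
      ⟨h, (degree_sum_fin_lt u).trans_eq (degree_eq_natDegree hf.ne_zero).symm⟩
    rw [zero_divByMonic] at hq
    rw [zero_modByMonic] at hr
    refine ⟨?_, hq.symm⟩
    ext t
    have := congrArg (fun p => coeff p t.1) hr.symm
    simpa [coeff_X_pow, finsetSum_coeff, Fin.val_inj] using this

lemma HasDivision.comp_ringEquiv {A S T : Type*} [CommRing A] [CommRing S] [CommRing T]
    {c : A →+* S} {δ x : S} {d : ℕ} (h : HasDivision c δ x d) (e : S ≃+* T) :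
    HasDivision ((e : S →+* T).comp c) (e δ) (e x) d := by
  constructor
  · intro y
    obtain ⟨u, q, hy⟩ := h.1 (e.symm y)
    exact ⟨u, e q, by simpa using congrArg e hy⟩
  · intro u q h0
    obtain ⟨hu, hq⟩ := h.2 u (e.symm q) (by simpa using congrArg e.symm h0)
    exact ⟨hu, by simpa using hq⟩

lemma HasDivision.isSMulRegular {A S : Type*} [CommRing A] [CommRing S]
    {c : A →+* S} {δ x : S} {d : ℕ} (h : HasDivision c δ x d) : IsSMulRegular S δ := by
  refine isSMulRegular_iff_right_eq_zero_of_smul.mpr fun q hq => ?_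
  exact (h.2 0 q (by simpa using hq)).2

/-- If `S` has division with remainder by `δ`, then the powers of `x` form a basis of a quotient
of `S` by the ideal generated by `δ`. -/
noncomputable def HasDivision.basis {A S : Type*} [CommRing A] [CommRing S] [Algebra A S]
    {δ x : S} {d : ℕ} (h : HasDivision (algebraMap A S) δ x d) {I : Ideal S}
    (hI : I = Ideal.span {δ}) : Module.Basis (Fin d) A (S ⧸ I) :=
  .mk (v := fun s => Ideal.Quotient.mk I (x ^ s.1))
    (by
      rw [Fintype.linearIndependent_iff]
      intro u hu
      have hmem : ∑ s, algebraMap A S (u s) * x ^ s.1 ∈ I := by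
        rw [← Ideal.Quotient.eq_zero_iff_mem, map_sum, ← hu]
        simp [Algebra.smul_def, Ideal.Quotient.mk_algebraMap]
      rw [hI, Ideal.mem_span_singleton'] at hmem
      obtain ⟨q, hq⟩ := hmem
      exact congrFun (h.2 u (-q) (by rw [← hq]; ring)).1)
    (by
      rintro y -
      obtain ⟨y, rfl⟩ := Ideal.Quotient.mk_surjective y
      obtain ⟨u, q, rfl⟩ := h.1 y
      have hδ : Ideal.Quotient.mk I δ = 0 := by
        rw [Ideal.Quotient.eq_zero_iff_mem, hI]
        exact Ideal.mem_span_singleton_self δ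
      rw [map_add, map_mul, hδ, zero_mul, add_zero, map_sum]
      refine Submodule.sum_mem _ fun s _ => ?_
      rw [map_mul, Ideal.Quotient.mk_algebraMap, ← Algebra.smul_def]
      exact Submodule.smul_mem _ _ (Submodule.subset_span ⟨s, rfl⟩))

lemma HasDivision.basis_apply {A S : Type*} [CommRing A] [CommRing S] [Algebra A S]
    {δ x : S} {d : ℕ} (h : HasDivision (algebraMap A S) δ x d) {I : Ideal S}
    (hI : I = Ideal.span {δ}) (s : Fin d) :
    h.basis hI s = Ideal.Quotient.mk I (x ^ s.1) := by
  simp [HasDivision.basis]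

lemma IsBaseChange.of_bases {A A' M M' ι : Type*} [CommRing A] [CommRing A'] [Algebra A A']
    [AddCommGroup M] [AddCommGroup M'] [Module A M] [Module A M'] [Module A' M']
    [IsScalarTower A A' M'] (b : Module.Basis ι A M) (b' : Module.Basis ι A' M')
    (f : M →ₗ[A] M') (hf : ∀ i, f (b i) = b' i) : IsBaseChange A' f := by
  refine IsBaseChange.of_equiv ((b.baseChange A').equiv b' (Equiv.refl ι)) fun y => ?_
  have : ((((b.baseChange A').equiv b' (Equiv.refl ι)).toLinearMap.restrictScalars A).comp
      (TensorProduct.mk A A' M 1)) = f := by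
    refine b.ext fun i => ?_
    simp [hf, ← Module.Basis.baseChange_apply]
  exact LinearMap.congr_fun this y

lemma Module.FaithfullyFlat.quotient_of_hasDivision {A A' R S : Type*} [CommRing A] [CommRing A']
    [CommRing R] [CommRing S] [Algebra A A'] [Algebra A R] [Algebra A S] [Algebra A' S]
    [Algebra R S] [IsScalarTower A A' S] [IsScalarTower A R S] [Module.FaithfullyFlat A A']
    {δ x : R} {d : ℕ} (hR : HasDivision (algebraMap A R) δ x d)
    (hS : HasDivision (algebraMap A' S) (algebraMap R S δ) (algebraMap R S x) d) :
    Module.FaithfullyFlat (R ⧸ Ideal.span {δ})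
      (S ⧸ (Ideal.span {δ}).map (algebraMap R S)) := by
  have hI : (Ideal.span {δ}).map (algebraMap R S) = Ideal.span {algebraMap R S δ} := by
    rw [Ideal.map_span, Set.image_singleton]
  have : IsScalarTower A (R ⧸ Ideal.span {δ}) (S ⧸ (Ideal.span {δ}).map (algebraMap R S)) :=
    .of_algebraMap_eq fun a => by
      rw [IsScalarTower.algebraMap_apply A S, IsScalarTower.algebraMap_apply A R S]
      rfl
  have hpush : Algebra.IsPushout A A' (R ⧸ Ideal.span {δ})
      (S ⧸ (Ideal.span {δ}).map (algebraMap R S)) := by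
    refine ⟨IsBaseChange.of_bases (hR.basis rfl) (hS.basis hI) _ fun s => ?_⟩
    rw [hR.basis_apply, hS.basis_apply, ← map_pow]
    rfl
  exact Module.FaithfullyFlat.of_linearEquiv _ (TensorProduct A (R ⧸ Ideal.span {δ}) A')
    hpush.symm.out.equiv.symm

/-- A relation over `R` in `S` is trivial up to multiples of `δ` if the quotient `S'` of `S` by `δ`
is flat over the quotient `R'` of `R` by `δ`. -/
lemma Module.Flat.exists_factorization_of_quotient {R S R' S' : Type*} [CommRing R] [CommRing S]
    [CommRing R'] [CommRing S'] [Algebra R S] [Algebra R' S'] [Module.Flat R' S'] {δ : R}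
    {π : R →+* R'} {ρ : S →+* S'} (hπ : Function.Surjective π) (hρ : Function.Surjective ρ)
    (hπδ : RingHom.ker π = Ideal.span {δ}) (hρδ : RingHom.ker ρ = Ideal.span {algebraMap R S δ})
    (hcomm : ∀ r, algebraMap R' S' (π r) = ρ (algebraMap R S r)) {l : ℕ}
    {a : Fin l → R} {m : Fin l → S} (hz : ∑ j, a j • m j = 0) :
    ∃ (k : ℕ) (b : Fin l → Fin k → R) (y : Fin k → S),
      (∀ j, ∃ q, m j = ∑ i, b j i • y i + δ • q) ∧ ∀ i, ∃ c, ∑ j, a j * b j i = c * δ := by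
  have hsmul (r : R) (t : S) : π r • ρ t = ρ (r • t) := by
    rw [Algebra.smul_def r, map_mul, Algebra.smul_def, hcomm]
  have hrel : ∑ j, π (a j) • ρ (m j) = 0 := by
    simp_rw [hsmul, ← map_sum]
    rw [hz, map_zero]
  obtain ⟨k, b, y, hb, hab⟩ := Module.Flat.isTrivialRelation_of_sum_smul_eq_zero (R := R') (M := S')
    (f := fun j => π (a j)) (x := fun j => ρ (m j)) hrel
  choose b' hb' using fun j i => hπ (b j i)
  choose y' hy' using fun i => hρ (y i)
  refine ⟨k, b', y', fun j => ?_, fun i => ?_⟩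
  · have : m j - ∑ i, b' j i • y' i ∈ RingHom.ker ρ := by
      rw [RingHom.mem_ker, map_sub, sub_eq_zero, map_sum]
      refine (hb j).trans ?_
      refine Finset.sum_congr rfl fun i _ => ?_
      rw [← hb', ← hy', hsmul]
    rw [hρδ, Ideal.mem_span_singleton'] at this
    obtain ⟨q, hq⟩ := this
    exact ⟨q, by rw [Algebra.smul_def δ, mul_comm, hq]; ring⟩
  · have : ∑ j, a j * b' j i ∈ RingHom.ker π := by
      rw [RingHom.mem_ker, ← hab i, map_sum]
      simp [hb']
    rw [hπδ] at this
    obtain ⟨c, hc⟩ := Ideal.mem_span_singleton'.mp this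
    exact ⟨c, hc.symm⟩

open TensorProduct in
/-- If every nonzero ideal of `R` contains an `S`-regular `δ` for which `S / δ S` is flat
over `R / δ R`, then `S` is flat over `R`. -/
lemma Module.Flat.of_forall_exists_quotient {R S : Type*} [CommRing R] [CommRing S] [Algebra R S]
    (h : ∀ I : Ideal R, I ≠ ⊥ → ∃ δ ∈ I, IsSMulRegular S (algebraMap R S δ) ∧
      Module.Flat (R ⧸ Ideal.span {δ}) (S ⧸ (Ideal.span {δ}).map (algebraMap R S))) :
    Module.Flat R S := by
  refine Module.Flat.iff_lift_lsmul_comp_subtype_injective.mpr fun I _ => ?_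
  by_cases hI : I = ⊥
  · subst hI
    exact Function.injective_of_subsingleton _
  obtain ⟨δ, hδ, hreg, hflat⟩ := h I hI
  rw [injective_iff_map_eq_zero]
  intro z hz
  suffices ∃ w : S, z = (⟨δ, hδ⟩ : I) ⊗ₜ[R] w by
    obtain ⟨w, rfl⟩ := this
    have hw : algebraMap R S δ • w = 0 := by
      simpa [Algebra.smul_def] using hz
    rw [isSMulRegular_iff_right_eq_zero_of_smul.mp hreg w hw, tmul_zero]
  obtain ⟨l, a, m, rfl⟩ := TensorProduct.exists_sum_tmul_eq z
  obtain ⟨k, b, y, hm, hc⟩ := Module.Flat.exists_factorization_of_quotient (δ := δ)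
    (Ideal.Quotient.mk_surjective (I := Ideal.span {δ}))
    (Ideal.Quotient.mk_surjective (I := (Ideal.span {δ}).map (algebraMap R S)))
    Ideal.mk_ker (by rw [Ideal.mk_ker, Ideal.map_span, Set.image_singleton]) (fun _ => rfl)
    (a := fun j => (a j : R)) (m := m) (by simpa using hz)
  choose q hq using hm
  choose c hc using hc
  have hc' (i) : ∑ j, b j i • a j = c i • (⟨δ, hδ⟩ : I) := by
    ext
    simpa [mul_comm] using hc i
  have hswap (j) : δ • a j = (a j : R) • (⟨δ, hδ⟩ : I) := by
    ext
    simp [mul_comm]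
  refine ⟨∑ i, c i • y i + ∑ j, (a j : R) • q j, ?_⟩
  calc ∑ j, a j ⊗ₜ[R] m j
      = ∑ j, ∑ i, (b j i • a j) ⊗ₜ[R] y i + ∑ j, (δ • a j) ⊗ₜ[R] q j := by
        rw [← Finset.sum_add_distrib]
        refine Finset.sum_congr rfl fun j _ => ?_
        rw [hq j, tmul_add, tmul_sum, smul_tmul]
        simp_rw [smul_tmul]
    _ = _ := by
        rw [Finset.sum_comm]
        simp_rw [← sum_tmul, hc', hswap, smul_tmul, tmul_add, tmul_sum]

lemma Module.FaithfullyFlat.of_forall_exists_quotient {R S : Type*} [CommRing R] [CommRing S]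
    [Algebra R S] [Nontrivial S]
    (h : ∀ I : Ideal R, I ≠ ⊥ → ∃ δ ∈ I, IsSMulRegular S (algebraMap R S δ) ∧
      Module.FaithfullyFlat (R ⧸ Ideal.span {δ})
        (S ⧸ (Ideal.span {δ}).map (algebraMap R S))) :
    Module.FaithfullyFlat R S := by
  rw [Module.FaithfullyFlat.iff_flat_and_proper_ideal]
  refine ⟨.of_forall_exists_quotient fun I hI => ?_, fun I hI htop => ?_⟩
  · obtain ⟨δ, hδ, hreg, _⟩ := h I hI
    exact ⟨δ, hδ, hreg, inferInstance⟩
  by_cases h0 : I = ⊥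
  · subst h0
    simp at htop
  obtain ⟨δ, hδ, -, hff⟩ := h I h0
  have hδI : Ideal.span {δ} ≤ I := (Ideal.span_singleton_le_iff_mem I).mpr hδ
  have htop' : I.map (algebraMap R S) = ⊤ := by
    rw [Ideal.smul_top_eq_map] at htop
    exact (Submodule.restrictScalars_eq_top_iff R S S).mp htop
  have hmap : (I.map (Ideal.Quotient.mk (Ideal.span {δ}))).map
      (algebraMap (R ⧸ Ideal.span {δ}) (S ⧸ (Ideal.span {δ}).map (algebraMap R S))) = ⊤ := by
    have := congrArg (Ideal.map (Ideal.Quotient.mk ((Ideal.span {δ}).map (algebraMap R S)))) htop'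
    rw [Ideal.map_top, Ideal.map_map] at this
    rwa [Ideal.map_map]
  have hquot := Ideal.comap_map_eq_self_of_faithfullyFlat
    (B := S ⧸ (Ideal.span {δ}).map (algebraMap R S)) (I.map (Ideal.Quotient.mk (Ideal.span {δ})))
  rw [hmap, Ideal.comap_top] at hquot
  have := Ideal.comap_map_of_surjective' _ (Ideal.Quotient.mk_surjective (I := Ideal.span {δ})) I
  rw [← hquot, Ideal.comap_top, Ideal.mk_ker, sup_eq_left.mpr hδI] at this
  exact hI this.symm

/-- The ultraproduct of a sequence of commutative rings. -/
def Ultraproduct (𝒰 : Ultrafilter ℕ) (A : ℕ → Type*) [∀ m, CommRing (A m)] : Type _ :=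
  (∀ m, A m) ⧸ ultraIdeal 𝒰 A

namespace Ultraproduct

section

variable {𝒰 : Ultrafilter ℕ} {A B : ℕ → Type*} [∀ m, CommRing (A m)] [∀ m, CommRing (B m)]

instance : CommRing (Ultraproduct 𝒰 A) :=
  inferInstanceAs (CommRing ((∀ m, A m) ⧸ ultraIdeal 𝒰 A))

variable (𝒰 A) in
/-- The class of a sequence in the ultraproduct. -/
def mk : (∀ m, A m) →+* Ultraproduct 𝒰 A := Ideal.Quotient.mk (ultraIdeal 𝒰 A)

lemma mk_surjective : Function.Surjective (mk 𝒰 A) := Ideal.Quotient.mk_surjective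

lemma mk_eq_zero {a : ∀ m, A m} : mk 𝒰 A a = 0 ↔ ∀ᶠ m in (𝒰 : Filter ℕ), a m = 0 :=
  Ideal.Quotient.eq_zero_iff_mem

variable (𝒰) in
/-- The ring homomorphism of ultraproducts induced by a sequence of ring homomorphisms. -/
def map (f : ∀ m, A m →+* B m) : Ultraproduct 𝒰 A →+* Ultraproduct 𝒰 B :=
  Ideal.Quotient.lift _ ((mk 𝒰 B).comp (RingHom.pi fun m => (f m).comp (Pi.evalRingHom A m)))
    fun a ha => mk_eq_zero.mpr ((mk_eq_zero.mp (Ideal.Quotient.eq_zero_iff_mem.mpr ha)).mono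
      fun m hm => by
        change f m (a m) = 0
        rw [hm, map_zero])

lemma map_mk (f : ∀ m, A m →+* B m) (a : ∀ m, A m) :
    map 𝒰 f (mk 𝒰 A a) = mk 𝒰 B fun m => f m (a m) := rfl

instance [∀ m, Nontrivial (A m)] : Nontrivial (Ultraproduct 𝒰 A) := by
  refine ⟨0, 1, fun h => ?_⟩
  obtain ⟨m, hm⟩ := ((mk_eq_zero (𝒰 := 𝒰) (A := A) (a := 1)).mp (by rw [map_one, h])).exists
  exact one_ne_zero hm

lemma isField (𝒰 : Ultrafilter ℕ) (L : ℕ → Type*) [∀ m, Field (L m)] :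
    IsField (Ultraproduct 𝒰 L) := by
  refine ⟨⟨0, 1, zero_ne_one⟩, mul_comm, fun {a} ha => ?_⟩
  obtain ⟨a, rfl⟩ := mk_surjective a
  refine ⟨mk 𝒰 L fun m => (a m)⁻¹, ?_⟩
  rw [← sub_eq_zero, ← map_one (mk 𝒰 L), ← map_mul, ← map_sub, mk_eq_zero]
  have : ∀ᶠ m in (𝒰 : Filter ℕ), a m ≠ 0 :=
    Ultrafilter.eventually_not.mpr fun h => ha (mk_eq_zero.mpr h)
  filter_upwards [this] with m hm
  simp [hm]

lemma hasDivision {c : ∀ m, A m →+* B m} {δ x : ∀ m, B m} {d : ℕ}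
    (h : ∀ m, HasDivision (c m) (δ m) (x m) d) :
    HasDivision (map 𝒰 c) (mk 𝒰 B δ) (mk 𝒰 B x) d := by
  have key (u : Fin d → ∀ m, A m) (q : ∀ m, B m) :
      ∑ s, map 𝒰 c (mk 𝒰 A (u s)) * mk 𝒰 B x ^ s.1 + mk 𝒰 B δ * mk 𝒰 B q =
        mk 𝒰 B fun m => ∑ s, c m (u s m) * x m ^ s.1 + δ m * q m := by
    simp_rw [map_mk, ← map_pow, ← map_mul, ← map_sum, ← map_add]
    congr 1
    ext m
    simp
  constructor
  · intro y
    obtain ⟨y, rfl⟩ := mk_surjective y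
    choose u q huq using fun m => (h m).1 (y m)
    refine ⟨fun s => mk 𝒰 A fun m => u m s, mk 𝒰 B q, ?_⟩
    rw [key]
    exact congrArg _ (funext huq)
  · intro u q h0
    choose u' hu' using fun s => mk_surjective (u s)
    obtain ⟨q, rfl⟩ := mk_surjective q
    obtain rfl : (fun s => mk 𝒰 A (u' s)) = u := funext hu'
    rw [key, mk_eq_zero] at h0
    constructor
    · ext s
      refine mk_eq_zero.mpr (h0.mono fun m hm => ?_)
      exact congrFun ((h m).2 (fun s => u' s m) (q m) hm).1 s
    · exact mk_eq_zero.mpr (h0.mono fun m hm => ((h m).2 (fun s => u' s m) (q m) hm).2)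

end

section

open MvPolynomial

variable (𝒰 : Ultrafilter ℕ) (L : ℕ → Type*) [∀ m, Field (L m)]

/-- The natural homomorphism from polynomials over an ultraproduct to internal polynomials. -/
noncomputable def ofMvPolynomial (n : ℕ) : MvPolynomial (Fin n) (Ultraproduct 𝒰 L) →+*
    Ultraproduct 𝒰 fun m => MvPolynomial (Fin n) (L m) :=
  eval₂Hom (map 𝒰 fun _ => C) fun i => mk 𝒰 _ fun _ => X i

variable {𝒰 L}

lemma ofMvPolynomial_X {n : ℕ} (i : Fin n) :
    ofMvPolynomial 𝒰 L n (X i) = mk 𝒰 _ fun _ => X i := by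
  simp [ofMvPolynomial]

lemma ofMvPolynomial_C {n : ℕ} (a : ∀ m, L m) :
    ofMvPolynomial 𝒰 L n (C (mk 𝒰 L a)) = mk 𝒰 _ fun m => C (a m) := by
  simp [ofMvPolynomial, map_mk]

lemma ofMvPolynomial_nagataC {n N : ℕ} (p : MvPolynomial (Fin n) (Ultraproduct 𝒰 L)) :
    ofMvPolynomial 𝒰 L (n + 1) (nagataC _ n N p) =
      map 𝒰 (fun m => nagataC (L m) n N) (ofMvPolynomial 𝒰 L n p) := by
  suffices (ofMvPolynomial 𝒰 L (n + 1)).comp (nagataC _ n N) =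
      (map 𝒰 fun m => nagataC (L m) n N).comp (ofMvPolynomial 𝒰 L n) from
    RingHom.congr_fun this p
  refine MvPolynomial.ringHom_ext (fun a => ?_) fun i => ?_
  · obtain ⟨a, rfl⟩ := mk_surjective a
    simp only [RingHom.comp_apply, nagataC_C, ofMvPolynomial_C, map_mk]
  · simp only [RingHom.comp_apply, nagataC_X, ofMvPolynomial_X, map_mk, map_sub, map_pow]
    rfl

/-- Lift a monic polynomial to a sequence of monic polynomials of the same degree. -/
lemma exists_monic_lift {n N : ℕ} {f : Polynomial (MvPolynomial (Fin n) (Ultraproduct 𝒰 L))}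
    (hf : f.Monic) : ∃ g : ∀ m, Polynomial (MvPolynomial (Fin n) (L m)),
      (∀ m, (g m).Monic ∧ (g m).natDegree = f.natDegree) ∧
      ofMvPolynomial 𝒰 L (n + 1) ((nagataEquiv _ n N).symm f) =
        mk 𝒰 _ fun m => (nagataEquiv (L m) n N).symm (g m) := by
  choose γ hγ using fun s => mk_surjective (ofMvPolynomial 𝒰 L n (f.coeff s))
  set d := f.natDegree with hd
  have hlt (m) : (∑ s : Fin d, Polynomial.C (γ s m) * Polynomial.X ^ s.1).degree <
      (Polynomial.X ^ d : Polynomial (MvPolynomial (Fin n) (L m))).degree :=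
    (Polynomial.degree_sum_fin_lt fun s : Fin d => γ s m).trans_eq (Polynomial.degree_X_pow d).symm
  refine ⟨fun m => Polynomial.X ^ d + ∑ s : Fin d, Polynomial.C (γ s m) * Polynomial.X ^ s.1,
    fun m => ⟨Polynomial.monic_X_pow_add ((hlt m).trans_eq (Polynomial.degree_X_pow d)), ?_⟩, ?_⟩
  · rw [Polynomial.natDegree_add_eq_left_of_degree_lt (hlt m),
      Polynomial.natDegree_X_pow]
  · conv_lhs => rw [hf.as_sum, ← hd, ← Fin.sum_univ_eq_sum_range
      (fun s => Polynomial.C (f.coeff s) * Polynomial.X ^ s)]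
    simp only [map_add, map_sum, map_mul, map_pow, nagataEquiv_symm_X, ofMvPolynomial_X,
      nagataEquiv_symm_C, ofMvPolynomial_nagataC, ← hγ, map_mk]
    simp_rw [← map_pow, ← map_mul, ← map_sum, ← map_add]
    congr 1
    ext1 m
    simp

/-- Division with remainder by a polynomial that is monic after Nagata's change of variables. -/
lemma _root_.MvPolynomial.hasDivision_nagataEquiv_symm {R : Type*} [CommRing R] [Nontrivial R]
    {n N : ℕ} {f : Polynomial (MvPolynomial (Fin n) R)} (hf : f.Monic) :
    HasDivision (nagataC R n N) ((nagataEquiv R n N).symm f) (X 0) f.natDegree := by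
  rw [← nagataEquiv_symm_X (N := N)]
  exact hf.hasDivision.comp_ringEquiv (nagataEquiv R n N).symm.toRingEquiv

theorem faithfullyFlat_ofMvPolynomial (n : ℕ) : (ofMvPolynomial 𝒰 L n).FaithfullyFlat := by
  let _ : Field (Ultraproduct 𝒰 L) := (isField 𝒰 L).toField
  induction n with
  | zero =>
    have hF : IsField (MvPolynomial (Fin 0) (Ultraproduct 𝒰 L)) :=
      (isEmptyRingEquiv _ _).toMulEquiv.isField (isField 𝒰 L)
    let _ : Field (MvPolynomial (Fin 0) (Ultraproduct 𝒰 L)) := hF.toField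
    let _ : Algebra (MvPolynomial (Fin 0) (Ultraproduct 𝒰 L))
      (Ultraproduct 𝒰 fun m => MvPolynomial (Fin 0) (L m)) := (ofMvPolynomial 𝒰 L 0).toAlgebra
    exact inferInstanceAs (Module.FaithfullyFlat (MvPolynomial (Fin 0) (Ultraproduct 𝒰 L))
      (Ultraproduct 𝒰 fun m => MvPolynomial (Fin 0) (L m)))
  | succ n ih =>
    let _ : Algebra (MvPolynomial (Fin (n + 1)) (Ultraproduct 𝒰 L))
      (Ultraproduct 𝒰 fun m => MvPolynomial (Fin (n + 1)) (L m)) :=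
        (ofMvPolynomial 𝒰 L (n + 1)).toAlgebra
    refine Module.FaithfullyFlat.of_forall_exists_quotient fun I hI => ?_
    obtain ⟨f, hfI, hf0⟩ := Submodule.exists_mem_ne_zero_of_ne_bot hI
    obtain ⟨N, a, hmonic⟩ := exists_monic_nagataEquiv hf0
    obtain ⟨g, hg, hfg⟩ := exists_monic_lift (N := N) hmonic
    rw [AlgEquiv.symm_apply_apply] at hfg
    set δ := C a * f
    have hR := hasDivision_nagataEquiv_symm (N := N) hmonic
    rw [AlgEquiv.symm_apply_apply] at hR
    have hS := Ultraproduct.hasDivision (𝒰 := 𝒰) fun m =>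
      (hg m).2 ▸ hasDivision_nagataEquiv_symm (N := N) (hg m).1
    rw [← hfg, ← ofMvPolynomial_X] at hS
    refine ⟨δ, I.mul_mem_left _ hfI, hS.isSMulRegular, ?_⟩
    let _ : Algebra (MvPolynomial (Fin n) (Ultraproduct 𝒰 L))
      (Ultraproduct 𝒰 fun m => MvPolynomial (Fin n) (L m)) := (ofMvPolynomial 𝒰 L n).toAlgebra
    let _ : Algebra (MvPolynomial (Fin n) (Ultraproduct 𝒰 L))
      (MvPolynomial (Fin (n + 1)) (Ultraproduct 𝒰 L)) :=
        (nagataC _ n N).toAlgebra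
    let _ : Algebra (Ultraproduct 𝒰 fun m => MvPolynomial (Fin n) (L m))
      (Ultraproduct 𝒰 fun m => MvPolynomial (Fin (n + 1)) (L m)) :=
        (map 𝒰 fun m => nagataC (L m) n N).toAlgebra
    let _ : Algebra (MvPolynomial (Fin n) (Ultraproduct 𝒰 L))
      (Ultraproduct 𝒰 fun m => MvPolynomial (Fin (n + 1)) (L m)) :=
        ((map 𝒰 fun m => nagataC (L m) n N).comp (ofMvPolynomial 𝒰 L n)).toAlgebra
    have : IsScalarTower (MvPolynomial (Fin n) (Ultraproduct 𝒰 L))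
      (Ultraproduct 𝒰 fun m => MvPolynomial (Fin n) (L m))
      (Ultraproduct 𝒰 fun m => MvPolynomial (Fin (n + 1)) (L m)) :=
        .of_algebraMap_eq fun _ => rfl
    have : IsScalarTower (MvPolynomial (Fin n) (Ultraproduct 𝒰 L))
      (MvPolynomial (Fin (n + 1)) (Ultraproduct 𝒰 L))
      (Ultraproduct 𝒰 fun m => MvPolynomial (Fin (n + 1)) (L m)) :=
        .of_algebraMap_eq fun p => (ofMvPolynomial_nagataC p).symm
    have : Module.FaithfullyFlat (MvPolynomial (Fin n) (Ultraproduct 𝒰 L))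
      (Ultraproduct 𝒰 fun m => MvPolynomial (Fin n) (L m)) := ih
    exact Module.FaithfullyFlat.quotient_of_hasDivision hR hS

end

end Ultraproduct

/-- van den Dries–Schmidt: the natural `k`-algebra map from the polynomial ring
`k[x_1,…,x_n]` over the ultraproduct `k = [L m]` to the ring of internal polynomials
`[L m[x_1,…,x_n]]` is injective and faithfully flat. The map `φ` is characterized as the
ring homomorphism sending each variable `X i` to the class of the constant sequence `X i`
and the constant `[a m]` to the class of the sequence of constants `C (a m)`. -/
theorem stmt7 (𝒰 : Ultrafilter ℕ) (hU : ∀ s : Set ℕ, s.Finite → s ∉ 𝒰)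
    (L : ℕ → Type*) [∀ m, Field (L m)] (n : ℕ) (hn : 1 ≤ n)
    (φ : MvPolynomial (Fin n) ((∀ m, L m) ⧸ ultraIdeal 𝒰 L) →+*
      (∀ m, MvPolynomial (Fin n) (L m)) ⧸ ultraIdeal 𝒰 (fun m => MvPolynomial (Fin n) (L m)))
    (hX : ∀ i : Fin n, φ (MvPolynomial.X i) =
      Ideal.Quotient.mk (ultraIdeal 𝒰 (fun m => MvPolynomial (Fin n) (L m)))
        (fun m => MvPolynomial.X i))
    (hC : ∀ a : ∀ m, L m, φ (MvPolynomial.C (Ideal.Quotient.mk (ultraIdeal 𝒰 L) a)) =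
      Ideal.Quotient.mk (ultraIdeal 𝒰 (fun m => MvPolynomial (Fin n) (L m)))
        (fun m => MvPolynomial.C (a m))) :
    Function.Injective φ ∧
      @Module.FaithfullyFlat (MvPolynomial (Fin n) ((∀ m, L m) ⧸ ultraIdeal 𝒰 L))
        ((∀ m, MvPolynomial (Fin n) (L m)) ⧸ ultraIdeal 𝒰 (fun m => MvPolynomial (Fin n) (L m)))
        _ _ (RingHom.toAlgebra φ).toModule := by
  obtain rfl : φ = Ultraproduct.ofMvPolynomial 𝒰 L n := by
    refine MvPolynomial.ringHom_ext (fun a => ?_) fun i => ?_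
    · obtain ⟨a, rfl⟩ := Ideal.Quotient.mk_surjective a
      exact (hC a).trans (Ultraproduct.ofMvPolynomial_C a).symm
    · exact (hX i).trans (Ultraproduct.ofMvPolynomial_X i).symm
  have h := Ultraproduct.faithfullyFlat_ofMvPolynomial (𝒰 := 𝒰) (L := L) n
  exact ⟨h.injective, h⟩
end

section
/- Let 𝒰 be a non-principal ultrafilter on ℕ, (L_m)_{m∈ℕ} a sequence of fields, k = [L_m] their ultraproduct, n ≥ 1, and let φ : k[x_1,…,x_n] → k[x_1,…,x_n]_int = [L_m[x_1,…,x_n]] be the natural k-algebra homomorphism sending each x_i to the class of the constant sequence (x_i). Then for every ideal 𝔞 ⊆ k[x_1,…,x_n], the contraction of the extended ideal equals 𝔞; that is, φ⁻¹(𝔞 · k[x_1,…,x_n]_int) = 𝔞. -/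
theorem mem_ultraIdeal {𝒰 : Ultrafilter ℕ} {A : ℕ → Type*} [∀ m, CommRing (A m)]
    {a : ∀ m, A m} : a ∈ ultraIdeal 𝒰 A ↔ {m | a m = 0} ∈ 𝒰 :=
  Iff.rfl

/-- An ultraproduct of fields is a field. -/
theorem isField_ultraproduct (𝒰 : Ultrafilter ℕ) (L : ℕ → Type*) [∀ m, Field (L m)] :
    IsField ((∀ m, L m) ⧸ ultraIdeal 𝒰 L) where
  exists_pair_ne := by
    refine ⟨0, 1, fun h => ?_⟩
    rw [eq_comm, ← map_one (Ideal.Quotient.mk (ultraIdeal 𝒰 L)), Ideal.Quotient.eq_zero_iff_mem,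
      mem_ultraIdeal] at h
    simp at h
  mul_comm := mul_comm
  mul_inv_cancel := by
    intro a ha
    obtain ⟨a, rfl⟩ := Ideal.Quotient.mk_surjective a
    rw [Ne, Ideal.Quotient.eq_zero_iff_mem, mem_ultraIdeal, ← Ultrafilter.compl_mem_iff_notMem]
      at ha
    refine ⟨Ideal.Quotient.mk _ fun m => (a m)⁻¹, ?_⟩
    rw [← map_mul, ← map_one (Ideal.Quotient.mk (ultraIdeal 𝒰 L)), Ideal.Quotient.eq,
      mem_ultraIdeal]
    filter_upwards [ha] with m hm
    simpa [sub_eq_zero] using mul_inv_cancel₀ hm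

/-- In a Noetherian ring, every ideal is an intersection of ideals of the form `𝔞 ⊔ 𝔪 ^ N` with
`𝔪` maximal. -/
theorem Ideal.exists_isMaximal_notMem_sup_pow {R : Type*} [CommRing R] [IsNoetherianRing R]
    {𝔞 : Ideal R} {f : R} (hf : f ∉ 𝔞) :
    ∃ 𝔪 : Ideal R, 𝔪.IsMaximal ∧ ∃ N : ℕ, f ∉ 𝔞 ⊔ 𝔪 ^ N := by
  have hne : 𝔞.colon {f} ≠ ⊤ := by
    rw [Ideal.ne_top_iff_one, Submodule.mem_colon_singleton]
    simpa using hf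
  obtain ⟨𝔪, hmax, hle⟩ := Ideal.exists_le_maximal _ hne
  refine ⟨𝔪, hmax, ?_⟩
  by_contra! hall
  have hmem : Ideal.Quotient.mk 𝔞 f ∈ (⨅ i : ℕ, 𝔪 ^ i • ⊤ : Submodule R (R ⧸ 𝔞)) := by
    rw [Submodule.mem_iInf]
    intro i
    obtain ⟨a, ha, b, hb, hab⟩ := Submodule.mem_sup.mp (hall i)
    have : Ideal.Quotient.mk 𝔞 f = b • (1 : R ⧸ 𝔞) := by
      rw [← hab, map_add, Ideal.Quotient.eq_zero_iff_mem.mpr ha, zero_add, Algebra.smul_def,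
        mul_one]
      rfl
    rw [this]
    exact Submodule.smul_mem_smul hb trivial
  obtain ⟨⟨r, hr⟩, hrf⟩ := (𝔪.mem_iInf_smul_pow_eq_bot_iff _).mp hmem
  refine hmax.ne_top ((Ideal.eq_top_iff_one _).mpr ?_)
  have h1 : 1 - r ∈ 𝔪 := by
    refine hle ?_
    rw [Submodule.mem_colon_singleton, ← Ideal.Quotient.eq_zero_iff_mem, smul_eq_mul, sub_mul,
      one_mul, map_sub, sub_eq_zero]
    exact hrf.symm
  simpa using add_mem h1 hr

/-- An element outside an ideal `𝔞` of a finitely generated algebra over a field is detected by a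
matrix representation annihilated by `𝔞`. -/
theorem Ideal.exists_algHom_matrix_of_notMem {K R : Type*} [Field K] [CommRing R] [Algebra K R]
    [Algebra.FiniteType K R] {𝔞 : Ideal R} {f : R} (hf : f ∉ 𝔞) :
    ∃ (d : ℕ) (ρ : R →ₐ[K] Matrix (Fin d) (Fin d) K), (∀ a ∈ 𝔞, ρ a = 0) ∧ ρ f ≠ 0 := by
  have : IsNoetherianRing R := Algebra.FiniteType.isNoetherianRing K R
  obtain ⟨𝔪, hmax, N, hN⟩ := Ideal.exists_isMaximal_notMem_sup_pow hf
  have hdim : Ring.KrullDimLE 0 (R ⧸ 𝔞 ⊔ 𝔪 ^ N) := by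
    rw [Ideal.krullDimLE_zero_quotient_iff_forall_minimalPrimes_isMaximal]
    intro J hJ
    have := hJ.1.1
    have hle : 𝔪 ≤ J := Ideal.IsPrime.le_of_pow_le (le_sup_right.trans hJ.1.2)
    rwa [← hmax.eq_of_le this.ne_top hle]
  have hfin : Module.Finite K (R ⧸ 𝔞 ⊔ 𝔪 ^ N) := (Module.finite_iff_krullDimLE_zero _ _).mpr hdim
  let b := Module.finBasis K (R ⧸ 𝔞 ⊔ 𝔪 ^ N)
  refine ⟨_, (Algebra.leftMulMatrix b).comp (Ideal.Quotient.mkₐ K _), fun a ha => ?_, fun h => ?_⟩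
  · have : Ideal.Quotient.mk (𝔞 ⊔ 𝔪 ^ N) a = 0 :=
      Ideal.Quotient.eq_zero_iff_mem.mpr (Ideal.mem_sup_left ha)
    simp [this]
  · refine hN (Ideal.Quotient.eq_zero_iff_mem.mp (Algebra.leftMulMatrix_injective b ?_))
    simpa using h

open scoped IsMulCommutative in
/-- A commuting family in a possibly noncommutative algebra induces an evaluation map on
multivariate polynomials. -/
theorem MvPolynomial.exists_algHom_of_commute {σ K A : Type*} [CommRing K] [Ring A] [Algebra K A]
    (x : σ → A) (hx : ∀ i j, x i * x j = x j * x i) :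
    ∃ e : MvPolynomial σ K →ₐ[K] A, ∀ i, e (X i) = x i := by
  have hcomm : IsMulCommutative (Algebra.adjoin K (Set.range x)) :=
    Algebra.isMulCommutative_adjoin K (by rintro _ ⟨i, rfl⟩ _ ⟨j, rfl⟩; exact hx i j)
  refine ⟨(Algebra.adjoin K (Set.range x)).val.comp
    (MvPolynomial.aeval fun i => (⟨x i, Algebra.subset_adjoin ⟨i, rfl⟩⟩ :
      Algebra.adjoin K (Set.range x))),
    fun i => ?_⟩
  simp

/-- A family of matrix representations of rings `A m` over `L m` induces a matrix
representation of the product of the `A m` over the ultraproduct of the `L m`. -/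
noncomputable def ultraMatrixRep (𝒰 : Ultrafilter ℕ) {L A : ℕ → Type*} [∀ m, CommRing (L m)]
    [∀ m, CommRing (A m)] {ι : Type*} [Fintype ι] [DecidableEq ι]
    (E : ∀ m, A m →+* Matrix ι ι (L m)) :
    (∀ m, A m) →+* Matrix ι ι ((∀ m, L m) ⧸ ultraIdeal 𝒰 L) :=
  (Ideal.Quotient.mk (ultraIdeal 𝒰 L)).mapMatrix.comp
    { toFun := fun p => Matrix.of fun i j m => E m (p m) i j
      map_one' := by
        ext i j m
        by_cases h : i = j <;> simp [Matrix.one_apply, h]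
      map_mul' := fun p q => by
        ext i j m
        simp [Matrix.mul_apply]
      map_zero' := by
        ext i j m
        simp
      map_add' := fun p q => by
        ext i j m
        simp }

theorem ultraMatrixRep_apply (𝒰 : Ultrafilter ℕ) {L A : ℕ → Type*} [∀ m, CommRing (L m)]
    [∀ m, CommRing (A m)] {ι : Type*} [Fintype ι] [DecidableEq ι]
    (E : ∀ m, A m →+* Matrix ι ι (L m)) (p : ∀ m, A m) (i j : ι) :
    ultraMatrixRep 𝒰 E p i j = Ideal.Quotient.mk (ultraIdeal 𝒰 L) fun m => E m (p m) i j :=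
  rfl

theorem ultraMatrixRep_eq_zero (𝒰 : Ultrafilter ℕ) {L A : ℕ → Type*} [∀ m, CommRing (L m)]
    [∀ m, CommRing (A m)] {ι : Type*} [Fintype ι] [DecidableEq ι]
    (E : ∀ m, A m →+* Matrix ι ι (L m)) (p : ∀ m, A m) (hp : p ∈ ultraIdeal 𝒰 A) :
    ultraMatrixRep 𝒰 E p = 0 := by
  ext i j
  rw [ultraMatrixRep_apply, Matrix.zero_apply, Ideal.Quotient.eq_zero_iff_mem, mem_ultraIdeal]
  filter_upwards [hp] with m hm
  simp [hm]

/-- Commuting matrices over an ultraproduct lift to families of commuting matrices over its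
factors. -/
theorem exists_commute_matrix_lift (𝒰 : Ultrafilter ℕ) {L : ℕ → Type*} [∀ m, CommRing (L m)]
    {σ ι : Type*} [Finite σ] [Fintype ι]
    (M : σ → Matrix ι ι ((∀ m, L m) ⧸ ultraIdeal 𝒰 L)) (hM : ∀ s t, M s * M t = M t * M s) :
    ∃ P : ∀ m, σ → Matrix ι ι (L m), (∀ m s t, P m s * P m t = P m t * P m s) ∧
      ∀ s i j, Ideal.Quotient.mk (ultraIdeal 𝒰 L) (fun m => P m s i j) = M s i j := by
  classical
  choose N hN using fun s i j => Ideal.Quotient.mk_surjective (I := ultraIdeal 𝒰 L) (M s i j)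
  let Q : ∀ m, σ → Matrix ι ι (L m) := fun m s => Matrix.of fun i j => N s i j m
  have hQ : ∀ᶠ m in (𝒰 : Filter ℕ), ∀ s t, Q m s * Q m t = Q m t * Q m s := by
    simp only [← Matrix.ext_iff, Filter.eventually_all]
    intro s t i j
    have h := congrFun (congrFun (hM s t) i) j
    simp only [Matrix.mul_apply, ← hN, ← map_mul, ← map_sum] at h
    rw [Ideal.Quotient.eq, mem_ultraIdeal] at h
    filter_upwards [h] with m hm
    simpa [Q, Matrix.mul_apply, sub_eq_zero] using hm
  refine ⟨fun m => if ∀ s t, Q m s * Q m t = Q m t * Q m s then Q m else 0, fun m s t => ?_,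
    fun s i j => ?_⟩
  · beta_reduce
    split_ifs with h
    · exact h s t
    · rfl
  · rw [← hN, Ideal.Quotient.eq, mem_ultraIdeal]
    filter_upwards [hQ] with m hm
    simp [if_pos hm, Q]

/-- For every ideal `𝔞` of `k[x_1,…,x_n]`, where `k = [L m]` is the ultraproduct of the
fields `L m`, the contraction of the extension of `𝔞` along the natural map `φ` to the ring
of internal polynomials `[L m[x_1,…,x_n]]` equals `𝔞`: `φ⁻¹(𝔞_int) = 𝔞`. The map `φ` is
characterized as the ring homomorphism sending each variable `X i` to the class of the
constant sequence `X i` and constants from `k` coefficientwise. -/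
theorem stmt8 (𝒰 : Ultrafilter ℕ) (hU : ∀ s : Set ℕ, s.Finite → s ∉ 𝒰)
    (L : ℕ → Type*) [∀ m, Field (L m)] (n : ℕ) (hn : 1 ≤ n)
    (φ : MvPolynomial (Fin n) ((∀ m, L m) ⧸ ultraIdeal 𝒰 L) →+*
      (∀ m, MvPolynomial (Fin n) (L m)) ⧸ ultraIdeal 𝒰 (fun m => MvPolynomial (Fin n) (L m)))
    (hX : ∀ i : Fin n, φ (MvPolynomial.X i) =
      Ideal.Quotient.mk (ultraIdeal 𝒰 (fun m => MvPolynomial (Fin n) (L m)))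
        (fun m => MvPolynomial.X i))
    (hC : ∀ a : ∀ m, L m, φ (MvPolynomial.C (Ideal.Quotient.mk (ultraIdeal 𝒰 L) a)) =
      Ideal.Quotient.mk (ultraIdeal 𝒰 (fun m => MvPolynomial (Fin n) (L m)))
        (fun m => MvPolynomial.C (a m))) :
    ∀ 𝔞 : Ideal (MvPolynomial (Fin n) ((∀ m, L m) ⧸ ultraIdeal 𝒰 L)),
      Ideal.comap φ (Ideal.map φ 𝔞) = 𝔞 := by
  intro 𝔞
  refine le_antisymm (fun f hf => ?_) Ideal.le_comap_map
  by_contra hfa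
  let _ : Field ((∀ m, L m) ⧸ ultraIdeal 𝒰 L) := (isField_ultraproduct 𝒰 L).toField
  obtain ⟨d, ρ, hρ, hρf⟩ :=
    Ideal.exists_algHom_matrix_of_notMem (K := (∀ m, L m) ⧸ ultraIdeal 𝒰 L) hfa
  obtain ⟨P, hPcomm, hP⟩ := exists_commute_matrix_lift 𝒰 (fun i => ρ (MvPolynomial.X i))
    fun i j => by rw [← map_mul, ← map_mul, mul_comm]
  choose E hE using fun m =>
    MvPolynomial.exists_algHom_of_commute (K := L m) (P m) (hPcomm m)
  let ψ := Ideal.Quotient.lift _ (ultraMatrixRep 𝒰 fun m => (E m).toRingHom)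
    (ultraMatrixRep_eq_zero 𝒰 _)
  have hψ : ψ.comp φ = ρ.toRingHom := by
    refine MvPolynomial.ringHom_ext (fun c => ?_) fun s => ?_
    · obtain ⟨a, rfl⟩ := Ideal.Quotient.mk_surjective c
      have hρC : ρ (MvPolynomial.C (Ideal.Quotient.mk (ultraIdeal 𝒰 L) a)) =
          algebraMap _ _ (Ideal.Quotient.mk (ultraIdeal 𝒰 L) a) := ρ.commutes _
      have hEC (m : ℕ) : E m (MvPolynomial.C (a m)) = algebraMap _ _ (a m) := (E m).commutes _
      simp only [RingHom.comp_apply, hC, ψ, Ideal.Quotient.lift_mk, AlgHom.toRingHom_eq_coe,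
        RingHom.coe_coe]
      rw [hρC]
      ext i j
      rw [ultraMatrixRep_apply]
      simp only [RingHom.coe_coe, hEC, Matrix.algebraMap_matrix_apply]
      split_ifs
      · rfl
      · exact map_zero _
    · simp only [RingHom.comp_apply, hX, ψ, Ideal.Quotient.lift_mk, AlgHom.toRingHom_eq_coe,
        RingHom.coe_coe]
      ext i j
      rw [ultraMatrixRep_apply, ← hP]
      simp only [RingHom.coe_coe, hE]
  have hker : 𝔞.map φ ≤ RingHom.ker ψ := by
    refine Ideal.map_le_iff_le_comap.mpr fun a ha => ?_
    rw [Ideal.mem_comap, RingHom.mem_ker, ← RingHom.comp_apply, hψ]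
    exact hρ a ha
  refine hρf ?_
  have h := hker (Ideal.mem_comap.mp hf)
  rwa [RingHom.mem_ker, ← RingHom.comp_apply, hψ] at h
end
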